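/- arXiv:1103.4371 — 2 statements merged into one kernel-verified Lean document; each statement's English description precedes it below -/
import Mathlib

section
/- Let μ be a Borel probability measure on ℝ with finite first moment ∫_ℝ |x| dμ(x) < ∞, and let m := ∫_ℝ x dμ(x). Then there exists a sequence (μ_n)_{n≥1} of Borel probability measures on ℝ, each with finite support, such that: (a) μ_n converges weakly to μ; (b) ∫_ℝ x dμ_n(x) = m for every n; (c) inf(supp μ_n) → inf(supp μ) in the extended reals [−∞, +∞] as n → ∞; and (d) sup(supp μ_n) → sup(supp μ) in the extended reals [−∞, +∞] as n → ∞. -/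
open MeasureTheory Filter Topology

/-- The support of a Borel measure on `ℝ`: the set of points all of whose open
neighbourhoods have positive measure. -/
def measureSupport (μ : MeasureTheory.Measure ℝ) : Set ℝ :=
  {x : ℝ | ∀ U : Set ℝ, IsOpen U → x ∈ U → 0 < μ U}

theorem measureSupport_eq_support (μ : Measure ℝ) : measureSupport μ = μ.support := by
  rw [Measure.support_eq_forall_isOpen]
  ext x
  exact forall_congr' fun U => forall_comm

theorem measureSupport_subset_of_isClosed {μ : Measure ℝ} {t : Set ℝ} (ht : IsClosed t)
    (h : ∀ᵐ x ∂μ, x ∈ t) : measureSupport μ ⊆ t := by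
  rw [measureSupport_eq_support]
  exact Measure.support_subset_of_isClosed ht h

theorem ae_mem_measureSupport (μ : Measure ℝ) : ∀ᵐ x ∂μ, x ∈ measureSupport μ := by
  rw [measureSupport_eq_support]
  exact Measure.support_mem_ae

/-- For an almost everywhere convergent sequence `g n → id` whose terms respect all almost sure
lower bounds of `μ`, the infima of the supports of the image measures converge. -/
theorem tendsto_sInf_measureSupport_map {μ : Measure ℝ} {g : ℕ → ℝ → ℝ}
    (hg : ∀ n, Measurable (g n))
    (hlim : ∀ᵐ x ∂μ, Tendsto (fun n => g n x) atTop (𝓝 x))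
    (hle : ∀ n a, (∀ᵐ x ∂μ, a ≤ x) → ∀ᵐ x ∂μ, a ≤ g n x) :
    Tendsto (fun n => sInf (Real.toEReal '' measureSupport (μ.map (g n)))) atTop
      (𝓝 (sInf (Real.toEReal '' measureSupport μ))) := by
  have hmem : ∀ᵐ x ∂μ, ∀ n, g n x ∈ measureSupport (μ.map (g n)) :=
    ae_all_iff.2 fun n => ae_of_ae_map (hg n).aemeasurable (ae_mem_measureSupport _)
  refine tendsto_order.2 ⟨fun b hb => .of_forall fun n => ?_, fun b hb => ?_⟩
  · obtain ⟨c, hbc, hc⟩ := EReal.lt_iff_exists_real_btwn.1 hb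
    refine hbc.trans_le (le_sInf ?_)
    rintro _ ⟨y, hy, rfl⟩
    have hcμ : ∀ᵐ x ∂μ, c ≤ x := by
      filter_upwards [ae_mem_measureSupport μ] with x hx
      exact EReal.coe_le_coe_iff.1 (hc.le.trans (sInf_le ⟨x, hx, rfl⟩))
    refine EReal.coe_le_coe_iff.2 (measureSupport_subset_of_isClosed isClosed_Ici ?_ hy)
    exact (ae_map_iff (hg n).aemeasurable measurableSet_Ici).2 (hle n c hcμ)
  · obtain ⟨_, ⟨y, hy, rfl⟩, hyb⟩ := sInf_lt_iff.1 hb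
    obtain ⟨c, hyc, hcb⟩ := EReal.lt_iff_exists_real_btwn.1 hyb
    have hpos : ∃ᵐ x ∂μ, x < c :=
      frequently_ae_iff.2 (hy _ isOpen_Iio (EReal.coe_lt_coe_iff.1 hyc)).ne'
    obtain ⟨x, hxc, hx, hxm⟩ := (hpos.and_eventually (hlim.and hmem)).exists
    filter_upwards [hx.eventually (gt_mem_nhds hxc)] with n hn
    exact (sInf_le (Set.mem_image_of_mem _ (hxm n))).trans_lt ((EReal.coe_lt_coe_iff.2 hn).trans hcb)

/-- For an almost everywhere convergent sequence `g n → id` whose terms respect all almost sure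
upper bounds of `μ`, the suprema of the supports of the image measures converge. -/
theorem tendsto_sSup_measureSupport_map {μ : Measure ℝ} {g : ℕ → ℝ → ℝ}
    (hg : ∀ n, Measurable (g n))
    (hlim : ∀ᵐ x ∂μ, Tendsto (fun n => g n x) atTop (𝓝 x))
    (hle : ∀ n a, (∀ᵐ x ∂μ, x ≤ a) → ∀ᵐ x ∂μ, g n x ≤ a) :
    Tendsto (fun n => sSup (Real.toEReal '' measureSupport (μ.map (g n)))) atTop
      (𝓝 (sSup (Real.toEReal '' measureSupport μ))) := by
  have hmem : ∀ᵐ x ∂μ, ∀ n, g n x ∈ measureSupport (μ.map (g n)) :=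
    ae_all_iff.2 fun n => ae_of_ae_map (hg n).aemeasurable (ae_mem_measureSupport _)
  refine tendsto_order.2 ⟨fun b hb => ?_, fun b hb => .of_forall fun n => ?_⟩
  · obtain ⟨_, ⟨y, hy, rfl⟩, hyb⟩ := lt_sSup_iff.1 hb
    obtain ⟨c, hbc, hcy⟩ := EReal.lt_iff_exists_real_btwn.1 hyb
    have hpos : ∃ᵐ x ∂μ, c < x :=
      frequently_ae_iff.2 (hy _ isOpen_Ioi (EReal.coe_lt_coe_iff.1 hcy)).ne'
    obtain ⟨x, hxc, hx, hxm⟩ := (hpos.and_eventually (hlim.and hmem)).exists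
    filter_upwards [hx.eventually (lt_mem_nhds hxc)] with n hn
    exact (hbc.trans (EReal.coe_lt_coe_iff.2 hn)).trans_le (le_sSup (Set.mem_image_of_mem _ (hxm n)))
  · obtain ⟨c, hc, hcb⟩ := EReal.lt_iff_exists_real_btwn.1 hb
    refine (sSup_le ?_).trans_lt hcb
    rintro _ ⟨y, hy, rfl⟩
    have hcμ : ∀ᵐ x ∂μ, x ≤ c := by
      filter_upwards [ae_mem_measureSupport μ] with x hx
      exact EReal.coe_le_coe_iff.1 ((le_sSup (Set.mem_image_of_mem _ hx)).trans hc.le)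
    refine EReal.coe_le_coe_iff.2 (measureSupport_subset_of_isClosed isClosed_Iic ?_ hy)
    exact (ae_map_iff (hg n).aemeasurable measurableSet_Iic).2 (hle n c hcμ)

/-- A function strongly measurable with respect to the σ-algebra generated by a simple function
has finite range. -/
theorem finite_range_of_stronglyMeasurable_comap {α β E : Type*} [MeasurableSpace α]
    [MeasurableSpace β] [TopologicalSpace E] [TopologicalSpace.PseudoMetrizableSpace E] [T1Space E]
    (f : SimpleFunc α β) {g : α → E}
    (hg : StronglyMeasurable[MeasurableSpace.comap f inferInstance] g) :
    (Set.range g).Finite := by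
  rcases isEmpty_or_nonempty E with hE | hE
  · exact Set.toFinite _
  obtain ⟨h, rfl⟩ := (Function.factorsThrough_iff g).1 hg.factorsThrough
  rw [Set.range_comp]
  exact f.finite_range.image h

/-- Conditional expectation does not move an integrable function further than twice its
`L¹`-distance to a measurable function. -/
theorem eLpNorm_condExp_sub_self_le {α : Type*} {m m₀ : MeasurableSpace α} {μ : Measure α}
    [IsFiniteMeasure μ] (hm : m ≤ m₀) {f g : α → ℝ} (hf : StronglyMeasurable[m] f)
    (hfi : Integrable f μ) (hgi : Integrable g μ) :
    eLpNorm (μ[g | m] - g) 1 μ ≤ 2 * eLpNorm (f - g) 1 μ := by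
  have h : μ[g | m] - g =ᵐ[μ] (f - g) - μ[f - g | m] := by
    filter_upwards [condExp_sub hfi hgi m] with x hx
    simp [hx, condExp_of_stronglyMeasurable hm hf hfi]
  rw [eLpNorm_congr_ae h, two_mul]
  refine (eLpNorm_sub_le (hfi.sub hgi).aestronglyMeasurable
    integrable_condExp.aestronglyMeasurable le_rfl).trans ?_
  gcongr
  exact eLpNorm_condExp_le_eLpNorm _ le_rfl

/-- The identity is an almost everywhere limit of conditional expectations of itself given
σ-algebras generated by simple functions. -/
theorem exists_simpleFunc_tendsto_condExp_id {μ : Measure ℝ} [IsFiniteMeasure μ]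
    (hμ : Integrable (fun x : ℝ => x) μ) :
    ∃ f : ℕ → SimpleFunc ℝ ℝ, ∀ᵐ x ∂μ,
      Tendsto (fun n => (μ[fun y : ℝ => y | MeasurableSpace.comap (f n) inferInstance]) x)
        atTop (𝓝 x) := by
  have hid : Measurable fun x : ℝ => x := measurable_id
  set f : ℕ → SimpleFunc ℝ ℝ :=
    SimpleFunc.approxOn _ hid (Set.range (fun x : ℝ => x) ∪ {0}) 0 (by simp)
  have hL1 : Tendsto (fun n => eLpNorm (⇑(f n) - fun x : ℝ => x) 1 μ) atTop (𝓝 0) := by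
    simp_rw [eLpNorm_one_eq_lintegral_enorm]
    exact SimpleFunc.tendsto_approxOn_range_L1_enorm hid hμ
  have hL1' : Tendsto (fun n => eLpNorm
      (μ[fun y : ℝ => y | MeasurableSpace.comap (f n) inferInstance] - fun x : ℝ => x) 1 μ)
      atTop (𝓝 0) := by
    refine tendsto_of_tendsto_of_tendsto_of_le_of_le tendsto_const_nhds
      (by simpa using ENNReal.Tendsto.const_mul (a := 2) hL1 (.inr ENNReal.ofNat_ne_top))
      (fun n => zero_le) fun n => ?_
    exact eLpNorm_condExp_sub_self_le (f n).measurable.comap_le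
      (comap_measurable (f n)).stronglyMeasurable
      (SimpleFunc.integrable_approxOn_range hid hμ n) hμ
  obtain ⟨ns, -, hns⟩ := (tendstoInMeasure_of_tendsto_eLpNorm one_ne_zero
    (fun n => integrable_condExp.aestronglyMeasurable)
    hμ.aestronglyMeasurable hL1').exists_seq_tendsto_ae
  exact ⟨fun n => f (ns n), hns⟩

/-- Any Borel probability measure on `ℝ` with finite first moment and mean `m`
can be approximated weakly by finitely supported probability measures with the same mean `m`,
in such a way that the infima and suprema of the supports converge in the extended reals. -/
theorem finite_support_approx_mean_and_supp_endpoints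
    (μ : Measure ℝ) [IsProbabilityMeasure μ]
    (hμ : Integrable (fun x : ℝ => |x|) μ) :
    ∃ μs : ℕ → Measure ℝ,
      (∀ n, IsProbabilityMeasure (μs n)) ∧
      (∀ n, ∃ s : Finset ℝ, (μs n) ((s : Set ℝ)ᶜ) = 0) ∧
      (∀ f : BoundedContinuousFunction ℝ ℝ,
        Tendsto (fun n => ∫ x, f x ∂(μs n)) atTop (𝓝 (∫ x, f x ∂μ))) ∧
      (∀ n, ∫ x, x ∂(μs n) = ∫ x, x ∂μ) ∧
      Tendsto (fun n => sInf (Real.toEReal '' measureSupport (μs n))) atTop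
        (𝓝 (sInf (Real.toEReal '' measureSupport μ))) ∧
      Tendsto (fun n => sSup (Real.toEReal '' measureSupport (μs n))) atTop
        (𝓝 (sSup (Real.toEReal '' measureSupport μ))) := by
  have hid : Integrable (fun x : ℝ => x) μ := (integrable_norm_iff (by fun_prop)).1 hμ
  obtain ⟨f, hlim⟩ := exists_simpleFunc_tendsto_condExp_id hid
  have hm : ∀ n, MeasurableSpace.comap (f n) inferInstance ≤ Real.measurableSpace :=
    fun n => (f n).measurable.comap_le
  set g : ℕ → ℝ → ℝ :=
    fun n => μ[fun y : ℝ => y | MeasurableSpace.comap (f n) inferInstance]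
  have hgm : ∀ n, Measurable (g n) := fun n => (stronglyMeasurable_condExp.mono (hm n)).measurable
  have hfin : ∀ n, (Set.range (g n)).Finite := fun n =>
    finite_range_of_stronglyMeasurable_comap (f n) stronglyMeasurable_condExp
  refine ⟨fun n => μ.map (g n), fun n => Measure.isProbabilityMeasure_map (hgm n).aemeasurable,
    fun n => ⟨(hfin n).toFinset, ?_⟩, fun φ => ?_, fun n => ?_,
    tendsto_sInf_measureSupport_map hgm hlim fun n a ha => ?_,
    tendsto_sSup_measureSupport_map hgm hlim fun n a ha => ?_⟩
  · rw [Measure.map_apply (hgm n) (Finset.measurableSet _).compl]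
    simp [Set.preimage_compl, Set.preimage_range]
  · simp_rw [integral_map (hgm _).aemeasurable φ.continuous.aestronglyMeasurable]
    refine tendsto_integral_of_dominated_convergence (fun _ => ‖φ‖)
      (fun n => (φ.continuous.measurable.comp (hgm n)).aestronglyMeasurable)
      (integrable_const _) (fun n => .of_forall fun x => φ.norm_coe_le_norm _) ?_
    filter_upwards [hlim] with x hx
    exact (φ.continuous.tendsto x).comp hx
  · rw [integral_map (hgm n).aemeasurable (by fun_prop)]
    exact integral_condExp (hm n)
  · have h := condExp_mono (m := MeasurableSpace.comap (f n) inferInstance)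
      (integrable_const a) hid ha
    rwa [condExp_const (hm n)] at h
  · have h := condExp_mono (m := MeasurableSpace.comap (f n) inferInstance)
      hid (integrable_const a) ha
    rwa [condExp_const (hm n)] at h
end

section
/- Let x₀ ≥ 0 and let c : [0,∞) → [0,∞) be a convex, nonincreasing function satisfying c(0) = x₀, lim_{K→∞} c(K) = 0, and c(K) ≥ max(x₀ − K, 0) for all K ≥ 0. Then there exists a Borel probability measure μ on [0,∞) such that ∫_{[0,∞)} x dμ(x) = x₀ and, for every K ≥ 0, ∫_{[0,∞)} max(x − K, 0) dμ(x) = c(K). -/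
open MeasureTheory Filter Topology
open scoped ENNReal

/-- If `h` is nonnegative on `(K, ∞)` and its integral over `(K, b]` is `c K - c b`, where `c`
vanishes at infinity, then its integral over `(K, ∞)` is `c K`. -/
theorem lintegral_Ioi_of_intervalIntegral_eq_sub {h c : ℝ → ℝ} {K : ℝ}
    (hint : ∀ b, IntegrableOn h (Set.Ioc K b)) (hnonneg : ∀ t, 0 ≤ h t)
    (heq : ∀ b, K ≤ b → ∫ t in K..b, h t = c K - c b) (hlim : Tendsto c atTop (𝓝 0)) :
    ∫⁻ t in Set.Ioi K, ENNReal.ofReal (h t) = ENNReal.ofReal (c K) := by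
  have hT : Tendsto (fun b => ∫ t in K..b, h t) atTop (𝓝 (c K)) := by
    have : Tendsto (fun b => c K - c b) atTop (𝓝 (c K)) := by
      simpa using hlim.const_sub (c K)
    refine this.congr' ?_
    filter_upwards [eventually_ge_atTop K] with b hb using (heq b hb).symm
  have hI : IntegrableOn h (Set.Ioi K) := by
    refine integrableOn_Ioi_of_intervalIntegral_norm_tendsto (c K) K hint tendsto_id ?_
    simpa [Real.norm_of_nonneg (hnonneg _)] using hT
  rw [← ofReal_integral_eq_lintegral_ofReal hI (ae_of_all _ hnonneg),
    tendsto_nhds_unique (intervalIntegral_tendsto_integral_Ioi K hI tendsto_id) hT]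

/-- If the tails `μ (t, ∞)` agree with `h t`, then the call prices of `μ` are the tail
integrals of `h`. -/
theorem lintegral_ofReal_sub_eq_lintegral_Ioi (μ : Measure ℝ) {h : ℝ → ℝ≥0∞}
    (hμ : ∀ t, μ (Set.Ioi t) = h t) (K : ℝ) :
    ∫⁻ x, ENNReal.ofReal (x - K) ∂μ = ∫⁻ t in Set.Ioi K, h t := by
  have hlayer := lintegral_eq_lintegral_meas_lt μ (f := fun x : ℝ => max (x - K) 0)
    (ae_of_all _ fun x => le_max_right _ _) (by fun_prop)
  have hshift := (measurePreserving_add_left volume K).setLIntegral_comp_preimage_emb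
    (MeasurableEquiv.addLeft K).measurableEmbedding h (Set.Ioi K)
  simp only [ENNReal.ofReal_max, ENNReal.ofReal_zero, max_zero] at hlayer
  rw [hlayer, ← hshift]
  have hpre : (fun x => K + x) ⁻¹' Set.Ioi K = Set.Ioi 0 := by ext; simp
  rw [hpre]
  refine setLIntegral_congr_fun measurableSet_Ioi fun t (ht : 0 < t) => ?_
  rw [← hμ]
  congr 1
  ext x
  simp only [Set.mem_ofPred_eq, lt_max_iff, ht.not_gt, or_false, Set.mem_Ioi]
  exact lt_sub_iff_add_lt'

/-- The right derivative on `(0, ∞)`, extended by `-1` to the left. -/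
noncomputable def rightDerivExtend (c : ℝ → ℝ) (t : ℝ) : ℝ :=
  if 0 < t then derivWithin c (Set.Ioi t) t else -1

theorem slope_le_rightDerivExtend {c : ℝ → ℝ} (hconvex : ConvexOn ℝ (Set.Ici (0 : ℝ)) c)
    {s t : ℝ} (hs : 0 ≤ s) (hst : s < t) : slope c s t ≤ rightDerivExtend c t := by
  have ht : t ∈ interior (Set.Ici (0 : ℝ)) := by simpa using hs.trans_lt hst
  rw [rightDerivExtend, if_pos (hs.trans_lt hst)]
  exact (hconvex.slope_le_leftDeriv_of_mem_interior hs ht hst).trans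
    (hconvex.leftDeriv_le_rightDeriv_of_mem_interior ht)

theorem rightDerivExtend_nonpos {c : ℝ → ℝ} (hconvex : ConvexOn ℝ (Set.Ici (0 : ℝ)) c)
    (hanti : AntitoneOn c (Set.Ici (0 : ℝ))) (t : ℝ) : rightDerivExtend c t ≤ 0 := by
  rw [rightDerivExtend]
  split_ifs with ht
  · have ht1 : t + 1 ∈ Set.Ici (0 : ℝ) := by simp only [Set.mem_Ici]; linarith
    refine (hconvex.rightDeriv_le_slope_of_mem_interior (by simpa using ht) ht1
      (lt_add_one t)).trans ?_
    have := hanti ht.le ht1 (lt_add_one t).le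
    rw [slope_def_field]
    simpa using this
  · norm_num

theorem monotone_rightDerivExtend {c : ℝ → ℝ} (hconvex : ConvexOn ℝ (Set.Ici (0 : ℝ)) c)
    (hlower : ∀ K, 0 ≤ K → c 0 - K ≤ c K) : Monotone (rightDerivExtend c) := by
  intro s t hst
  by_cases hs : 0 < s
  · have ht := hs.trans_le hst
    have := hconvex.monotoneOn_rightDeriv (by simpa using hs) (by simpa using ht) hst
    simpa [rightDerivExtend, hs, ht] using this
  · by_cases ht : 0 < t
    · have h1 := slope_le_rightDerivExtend hconvex le_rfl ht
      have h2 : -1 ≤ slope c 0 t := by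
        rw [slope_def_field, le_div_iff₀ (by linarith)]
        linarith [hlower t ht.le]
      simpa [rightDerivExtend, hs] using h2.trans h1
    · simp [rightDerivExtend, hs, ht]

theorem tendsto_rightDerivExtend {c : ℝ → ℝ} (hconvex : ConvexOn ℝ (Set.Ici (0 : ℝ)) c)
    (hanti : AntitoneOn c (Set.Ici (0 : ℝ))) (hlim : Tendsto c atTop (𝓝 0)) :
    Tendsto (rightDerivExtend c) atTop (𝓝 0) := by
  have h1 : Tendsto (fun t => c t - c (t - 1)) atTop (𝓝 0) := by
    simpa [← sub_eq_add_neg] using hlim.sub (hlim.comp (tendsto_atTop_add_const_right _ (-1) tendsto_id))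
  refine tendsto_of_tendsto_of_tendsto_of_le_of_le' h1 tendsto_const_nhds ?_
    (Eventually.of_forall (rightDerivExtend_nonpos hconvex hanti))
  filter_upwards [eventually_ge_atTop 1] with t ht
  simpa [slope_def_field] using
    slope_le_rightDerivExtend hconvex (sub_nonneg.2 ht) (sub_one_lt t)

/-- A convex function on `[0, ∞)` with `c 0 - K ≤ c K ≤ c 0` is continuous up to `0`. -/
theorem continuousOn_Ici_of_convexOn {c : ℝ → ℝ} (hconvex : ConvexOn ℝ (Set.Ici (0 : ℝ)) c)
    (hanti : AntitoneOn c (Set.Ici (0 : ℝ))) (hlower : ∀ K, 0 ≤ K → c 0 - K ≤ c K) :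
    ContinuousOn c (Set.Ici 0) := by
  intro x hx
  rcases (Set.mem_Ici.1 hx).eq_or_lt with rfl | hx0
  · have h1 : Tendsto (fun K => c 0 - K) (𝓝[Set.Ici 0] 0) (𝓝 (c 0)) := by
      have : Continuous fun K => c 0 - K := by fun_prop
      simpa using (this.tendsto 0).mono_left nhdsWithin_le_nhds
    refine tendsto_of_tendsto_of_tendsto_of_le_of_le' h1 tendsto_const_nhds ?_ ?_
    · filter_upwards [self_mem_nhdsWithin] with K hK using hlower K hK
    · filter_upwards [self_mem_nhdsWithin] with K hK using hanti hx hK hK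
  · have hmem : interior (Set.Ici (0 : ℝ)) ∈ 𝓝 x := by simpa using Ioi_mem_nhds hx0
    exact (hconvex.continuousOn_interior.continuousAt hmem).continuousWithinAt

theorem integral_rightDerivExtend {c : ℝ → ℝ} (hconvex : ConvexOn ℝ (Set.Ici (0 : ℝ)) c)
    (hanti : AntitoneOn c (Set.Ici (0 : ℝ))) (hlower : ∀ K, 0 ≤ K → c 0 - K ≤ c K)
    {K b : ℝ} (hK : 0 ≤ K) (hKb : K ≤ b) :
    ∫ t in K..b, rightDerivExtend c t = c b - c K := by
  refine intervalIntegral.integral_eq_sub_of_hasDeriv_right_of_le hKb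
    ((continuousOn_Ici_of_convexOn hconvex hanti hlower).mono
      (Set.Icc_subset_Ici_self.trans (Set.Ici_subset_Ici.2 hK))) (fun x hx => ?_)
    (monotone_rightDerivExtend hconvex hlower).intervalIntegrable
  have hx0 : 0 < x := hK.trans_lt hx.1
  rw [rightDerivExtend, if_pos hx0]
  exact hconvex.hasDerivWithinAt_rightDeriv_of_mem_interior (by simpa using hx0)

/-- Given a convex, nonincreasing candidate call-price function
`c : [0,∞) → [0,∞)` with `c 0 = x₀`, `c(∞) = 0` and `c(K) ≥ (x₀ - K)⁺`, there is a Borel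
probability measure `μ` on `[0,∞)` with mean `x₀` whose call prices are exactly `c`, i.e.
`∫ (x - K)⁺ μ(dx) = c K` for all `K ≥ 0`. -/
theorem exists_measure_with_given_call_prices
    (x₀ : ℝ) (hx₀ : 0 ≤ x₀)
    (c : ℝ → ℝ)
    (hnonneg : ∀ K, 0 ≤ K → 0 ≤ c K)
    (hconvex : ConvexOn ℝ (Set.Ici (0 : ℝ)) c)
    (hanti : AntitoneOn c (Set.Ici (0 : ℝ)))
    (hc0 : c 0 = x₀)
    (hlim : Tendsto c atTop (𝓝 0))
    (hlower : ∀ K, 0 ≤ K → max (x₀ - K) 0 ≤ c K) :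
    ∃ μ : Measure ℝ, IsProbabilityMeasure μ ∧
      μ (Set.Iio 0) = 0 ∧
      (∫⁻ x, ENNReal.ofReal x ∂μ) = ENNReal.ofReal x₀ ∧
      ∀ K : ℝ, 0 ≤ K → (∫⁻ x, ENNReal.ofReal (x - K) ∂μ) = ENNReal.ofReal (c K) := by
  have hlower' : ∀ K, 0 ≤ K → c 0 - K ≤ c K := fun K hK => by
    rw [hc0]; exact (le_max_left _ _).trans (hlower K hK)
  have hmono := monotone_rightDerivExtend hconvex hlower'
  have hnonpos := rightDerivExtend_nonpos hconvex hanti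
  set F := hmono.stieltjesFunction with hF
  have hF_le : ∀ {s t}, s < t → F s ≤ rightDerivExtend c t := fun h => hmono.rightLim_le h
  have le_hF : ∀ t, rightDerivExtend c t ≤ F t := fun t => hmono.le_rightLim le_rfl
  have hF_neg : ∀ t < 0, F t = -1 := fun t ht =>
    le_antisymm (by simpa [rightDerivExtend] using hF_le ht)
      (by simpa [rightDerivExtend, ht.not_gt] using le_hF t)
  have hF_bot : Tendsto F atBot (𝓝 (-1)) :=
    tendsto_const_nhds.congr' (by
      filter_upwards [eventually_lt_atBot 0] with t ht using (hF_neg t ht).symm)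
  have hF_top : Tendsto F atTop (𝓝 0) :=
    tendsto_of_tendsto_of_tendsto_of_le_of_le
      (tendsto_rightDerivExtend hconvex hanti hlim) tendsto_const_nhds le_hF
      fun t => (hF_le (lt_add_one t)).trans (hnonpos _)
  have hF_left : Function.leftLim F 0 = -1 :=
    leftLim_eq_of_tendsto (tendsto_const_nhds.congr' (by
      filter_upwards [self_mem_nhdsWithin] with t ht using (hF_neg t ht).symm))
  have hF_ae : F =ᵐ[volume] rightDerivExtend c := by
    filter_upwards [hmono.countable_not_continuousAt.ae_notMem volume] with t ht
    exact hmono.continuousWithinAt_Ioi_iff_rightLim_eq.1 (not_not.1 ht).continuousWithinAt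
  have hcall : ∀ K : ℝ, 0 ≤ K →
      (∫⁻ x, ENNReal.ofReal (x - K) ∂F.measure) = ENNReal.ofReal (c K) := fun K hK => by
    rw [lintegral_ofReal_sub_eq_lintegral_Ioi F.measure (F.measure_Ioi hF_top),
      ← lintegral_Ioi_of_intervalIntegral_eq_sub (h := fun t => -rightDerivExtend c t)
        (fun b => (hmono.locallyIntegrable.integrableOn_isCompact isCompact_Icc).neg.mono_set
          Set.Ioc_subset_Icc_self)
        (fun t => neg_nonneg.2 (hnonpos t)) (fun b hb => ?_) hlim]
    · refine lintegral_congr_ae (ae_restrict_of_ae ?_)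
      filter_upwards [hF_ae] with t ht
      rw [ht, zero_sub]
    · rw [intervalIntegral.integral_neg,
        integral_rightDerivExtend hconvex hanti hlower' hK hb, neg_sub]
  refine ⟨F.measure, ⟨?_⟩, ?_, ?_, hcall⟩
  · simp [F.measure_univ hF_bot hF_top]
  · simp [F.measure_Iio hF_bot, hF_left]
  · simpa [hc0] using hcall 0 le_rfl
end
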